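/- Let N be a finite set and f : Finset N → ℝ a normalized monotone submodular set function. For 0 ≤ t < |N| define g(t) = (C(|N|, t) · (|N| - t))^{-1} · Σ_{T ⊆ N, |T| = t} Σ_{x ∈ N \ T} (f(T ∪ {x}) - f(T)). Then for every s with 1 ≤ s ≤ |N|, the average value of f over all size-s subsets of N satisfies C(|N|, s)^{-1} · Σ_{S ⊆ N, |S| = s} f(S) ≥ s · g(s - 1). -/

import Mathlib

theorem aux_marg {N : Type*} [DecidableEq N] (f : Finset N → ℝ)
    (hsub : ∀ X Y : Finset N, X ⊆ Y → ∀ e ∉ Y,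
      f (insert e Y) - f Y ≤ f (insert e X) - f X) (S : Finset N) :
    ∑ x ∈ S, (f S - f (S.erase x)) ≤ f S - f ∅ := by
  induction S using Finset.induction_on with
  | empty => simp
  | insert a S ha ih =>
    rw [Finset.sum_insert ha, Finset.erase_insert ha]
    have : ∑ x ∈ S, (f (insert a S) - f ((insert a S).erase x))
        ≤ ∑ x ∈ S, (f S - f (S.erase x)) := by
      apply Finset.sum_le_sum
      intro x hx
      have h := hsub (S.erase x) ((insert a S).erase x)
        (Finset.erase_subset_erase _ (Finset.subset_insert _ _)) x (Finset.notMem_erase _ _)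
      rwa [Finset.insert_erase hx, Finset.insert_erase (Finset.mem_insert_of_mem hx)] at h
    linarith

theorem aux_double {N : Type*} [Fintype N] [DecidableEq N] (f : Finset N → ℝ) (t : ℕ) :
    ∑ T ∈ Finset.powersetCard t (Finset.univ : Finset N),
          ∑ x ∈ Finset.univ \ T, (f (insert x T) - f T)
    = ∑ S ∈ Finset.powersetCard (t + 1) (Finset.univ : Finset N),
          ∑ x ∈ S, (f S - f (S.erase x)) := by
  rw [Finset.sum_sigma', Finset.sum_sigma']
  refine Finset.sum_bij' (fun p _ => ⟨insert p.2 p.1, p.2⟩) (fun p _ => ⟨p.1.erase p.2, p.2⟩)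
    ?_ ?_ ?_ ?_ ?_
  · rintro ⟨T, x⟩ h
    simp at h ⊢
    rw [Finset.card_insert_of_notMem h.2, h.1]
  · rintro ⟨T, x⟩ h
    simp at h ⊢
    rw [Finset.card_erase_of_mem h.2, h.1]; rfl
  · rintro ⟨T, x⟩ h
    simp at h ⊢
    exact h.2
  · rintro ⟨T, x⟩ h
    simp at h ⊢
    exact Finset.insert_erase h.2
  · rintro ⟨T, x⟩ h
    simp at h ⊢
    rw [Finset.erase_eq_of_notMem h.2]


/-- For a normalized monotone submodular function on a finite
ground set `N`, the average value of `f` over all size-`s` subsets is at least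
`s · g (s - 1)`, where `g t` is the expected marginal gain of a uniformly random
element with respect to a uniformly random size-`t` subset. -/
theorem stmt_17 {N : Type*} [Fintype N] [DecidableEq N] (f : Finset N → ℝ)
    (hnorm : f ∅ = 0)
    (hmono : ∀ X Y : Finset N, X ⊆ Y → f X ≤ f Y)
    (hsub : ∀ X Y : Finset N, X ⊆ Y → ∀ e ∉ Y,
      f (insert e Y) - f Y ≤ f (insert e X) - f X)
    (g : ℕ → ℝ)
    (hg : ∀ t < Fintype.card N, g t =
      ((((Fintype.card N).choose t * (Fintype.card N - t) : ℕ) : ℝ))⁻¹ *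
        ∑ T ∈ Finset.powersetCard t (Finset.univ : Finset N),
          ∑ x ∈ Finset.univ \ T, (f (insert x T) - f T))
    (s : ℕ) (hs1 : 1 ≤ s) (hs2 : s ≤ Fintype.card N) :
    (((Fintype.card N).choose s : ℝ))⁻¹ *
        ∑ S ∈ Finset.powersetCard s (Finset.univ : Finset N), f S
      ≥ s * g (s - 1) := by
  obtain ⟨t, rfl⟩ : ∃ t, s = t + 1 := ⟨s - 1, by omega⟩
  rw [Nat.add_sub_cancel, hg t (by omega), aux_double, ← Nat.choose_succ_right_eq]
  have hc : (0 : ℝ) < ((Fintype.card N).choose (t + 1) : ℝ) := by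
    exact_mod_cast Nat.choose_pos hs2
  have ht : (0 : ℝ) < ((t + 1 : ℕ) : ℝ) := by positivity
  rw [ge_iff_le, ← mul_assoc, Nat.cast_mul, mul_inv, mul_comm (_)⁻¹ (_)⁻¹, ← mul_assoc,
    mul_inv_cancel₀ ht.ne', one_mul]
  refine mul_le_mul_of_nonneg_left (Finset.sum_le_sum fun S _ => ?_) (inv_nonneg.2 hc.le)
  have := aux_marg f hsub S
  linarith
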